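/- arXiv:1802.05223 — 2 statements merged into one kernel-verified Lean document; each statement's English description precedes it below -/
import Mathlib

section
/- Let f, g : (X,B) → (X',B') be admissible maps between marked spaces which are admissibly homotopic. Then the induced homomorphisms on marked homology H^M_n(f) and H^M_n(g) coincide for every n ≥ 0. -/
open scoped BigOperators
open Topology
noncomputable section

/-! ### Quasicones and marked spaces -/

/-- `B` is a *quasicone* with apex `b`: there is a homotopy `H` from the identity to the
constant map at `b` with `H ⁻¹' {b} = ({b} × I) ∪ (B × {1})`. -/
def IsQuasicone {B : Type*} [TopologicalSpace B] (b : B) : Prop :=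
  ∃ H : C(B × unitInterval, B),
    (∀ x, H (x, 0) = x) ∧ (∀ x, H (x, 1) = b) ∧
    (∀ x t, H (x, t) = b ↔ x = b ∨ t = 1)

/-- A *marked space* `(X, B)`: `B` is closed in `X` and every `b ∈ B` has a closed
quasiconical neighbourhood `F b` with apex `b`, the `F b` being pairwise disjoint. -/
structure IsMarkedSpace (X : Type*) [TopologicalSpace X] (B : Set X) : Prop where
  closed : IsClosed B
  quasicones : ∃ F : B → Set X,
    (∀ b : B, IsClosed (F b)) ∧ (∀ b : B, F b ∈ nhds (b : X)) ∧
    (∀ b b' : B, b ≠ b' → Disjoint (F b) (F b')) ∧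
    (∀ b : B, ∃ hb : (b : X) ∈ F b, IsQuasicone (⟨(b : X), hb⟩ : F b))

/-! ### Singular chains -/

/-- The topological standard `n`-simplex. -/
abbrev TopSimplex (n : ℕ) : Type := ↥(stdSimplex ℝ (Fin (n + 1)))

/-- Singular `n`-simplices in `X`. -/
abbrev SingularSimplex (X : Type*) [TopologicalSpace X] (n : ℕ) := C(TopSimplex n, X)

/-- Singular `n`-chains in `X` with coefficients in `R`. -/
abbrev SingularChain (R : Type*) [Ring R] (X : Type*) [TopologicalSpace X] (n : ℕ) :=
  SingularSimplex X n →₀ R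

/-- The `i`-th coface map, on barycentric coordinates. -/
def cofaceFun {n : ℕ} (i : Fin (n + 2)) (x : Fin (n + 1) → ℝ) : Fin (n + 2) → ℝ :=
  fun j => ∑ k : Fin (n + 1), if i.succAbove k = j then x k else 0

lemma cofaceFun_mem {n : ℕ} (i : Fin (n + 2)) {x : Fin (n + 1) → ℝ}
    (hx : x ∈ stdSimplex ℝ (Fin (n + 1))) : cofaceFun i x ∈ stdSimplex ℝ (Fin (n + 2)) := by
  constructor
  · intro j
    refine Finset.sum_nonneg fun k _ => ?_
    split_ifs
    · exact hx.1 k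
    · exact le_rfl
  · unfold cofaceFun
    rw [Finset.sum_comm]
    simp only [Finset.sum_ite_eq, Finset.mem_univ, if_true]
    exact hx.2

/-- The `i`-th face inclusion `Δⁿ → Δⁿ⁺¹`. -/
def coface {n : ℕ} (i : Fin (n + 2)) : C(TopSimplex n, TopSimplex (n + 1)) where
  toFun x := ⟨cofaceFun i (x : Fin (n + 1) → ℝ), cofaceFun_mem i x.2⟩
  continuous_toFun := by
    refine Continuous.subtype_mk ?_ _
    refine continuous_pi fun j => ?_
    unfold cofaceFun
    refine continuous_finset_sum _ fun k _ => ?_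
    by_cases h : i.succAbove k = j
    · simp only [if_pos h]
      exact (continuous_apply k).comp continuous_subtype_val
    · simp only [if_neg h]
      exact continuous_const

/-- The boundary of a single `(n+1)`-simplex. -/
def boundaryOf (R : Type*) [Ring R] {X : Type*} [TopologicalSpace X] {n : ℕ}
    (σ : SingularSimplex X (n + 1)) : SingularChain R X n :=
  ∑ i : Fin (n + 2), Finsupp.single (σ.comp (coface i)) ((-1 : R) ^ (i : ℕ))

/-- The singular boundary operator. -/
def boundary (R : Type*) [Ring R] (X : Type*) [TopologicalSpace X] (n : ℕ) :
    SingularChain R X (n + 1) →ₗ[R] SingularChain R X n :=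
  Finsupp.lsum ℕ fun σ => LinearMap.toSpanSingleton R _ (boundaryOf R σ)

/-- Push-forward of chains along a continuous map. -/
def pushChain (R : Type*) [Ring R] {X Y : Type*} [TopologicalSpace X] [TopologicalSpace Y]
    (f : C(X, Y)) (n : ℕ) : SingularChain R X n →ₗ[R] SingularChain R Y n :=
  Finsupp.lmapDomain R R fun σ : SingularSimplex X n => f.comp σ

/-- The face of `Δⁿ` spanned by the vertices in `S`. -/
def faceSet (n : ℕ) (S : Finset (Fin (n + 1))) : Set (TopSimplex n) :=
  {x | ∀ j ∉ S, (x : Fin (n + 1) → ℝ) j = 0}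

/-- A subset of `Δⁿ` which is a union of (not necessarily proper) faces. -/
def IsSimplicialSubcomplex {n : ℕ} (A : Set (TopSimplex n)) : Prop :=
  ∃ 𝒮 : Set (Finset (Fin (n + 1))), A = ⋃ S ∈ 𝒮, faceSet n S

/-- A singular simplex is *admissible* if the preimage of `B` is a union of faces. -/
def Admissible {X : Type*} [TopologicalSpace X] (B : Set X) {n : ℕ}
    (σ : SingularSimplex X n) : Prop :=
  IsSimplicialSubcomplex (σ ⁻¹' B)

/-- The submodule generated by admissible simplices. -/
def admissibleChains (R : Type*) [Ring R] (X : Type*) [TopologicalSpace X] (B : Set X)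
    (n : ℕ) : Submodule R (SingularChain R X n) :=
  Submodule.span R {c | ∃ σ : SingularSimplex X n, Admissible B σ ∧ c = Finsupp.single σ 1}

/-- The submodule generated by simplices supported in `B`. -/
def chainsIn (R : Type*) [Ring R] (X : Type*) [TopologicalSpace X] (B : Set X)
    (n : ℕ) : Submodule R (SingularChain R X n) :=
  Submodule.span R {c | ∃ σ : SingularSimplex X n, Set.range ⇑σ ⊆ B ∧ c = Finsupp.single σ 1}

/-- Cycles of the marked chain complex `C^M_*(X,B;R) = Ĉ^M_*(X,B;R)/C_*(B;R)`:
admissible chains whose boundary is supported in `B`. -/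
def markedCycles (R : Type*) [Ring R] (X : Type*) [TopologicalSpace X] (B : Set X) :
    (n : ℕ) → Submodule R (SingularChain R X n)
  | 0 => admissibleChains R X B 0
  | (n + 1) => admissibleChains R X B (n + 1) ⊓
      Submodule.comap (boundary R X n) (chainsIn R X B n)

/-- Boundaries of the marked chain complex. -/
def markedBoundaries (R : Type*) [Ring R] (X : Type*) [TopologicalSpace X] (B : Set X)
    (n : ℕ) : Submodule R (SingularChain R X n) :=
  Submodule.map (boundary R X n) (admissibleChains R X B (n + 1)) ⊔ chainsIn R X B n

/-- Relative cycles of the pair `(X, B)`. -/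
def relativeCycles (R : Type*) [Ring R] (X : Type*) [TopologicalSpace X] (B : Set X) :
    (n : ℕ) → Submodule R (SingularChain R X n)
  | 0 => ⊤
  | (n + 1) => Submodule.comap (boundary R X n) (chainsIn R X B n)

/-- Relative boundaries of the pair `(X, B)`. -/
def relativeBoundaries (R : Type*) [Ring R] (X : Type*) [TopologicalSpace X] (B : Set X)
    (n : ℕ) : Submodule R (SingularChain R X n) :=
  Submodule.map (boundary R X n) ⊤ ⊔ chainsIn R X B n

/-- The ℓ¹-norm of a real singular chain. -/
def l1Norm {X : Type*} [TopologicalSpace X] {n : ℕ} (c : SingularChain ℝ X n) : ℝ :=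
  c.sum fun _ r => |r|

/-! ### Affine maps into prisms -/

/-- The simplicial map `Δᵐ → Δⁿ` induced by a map of vertices. -/
def simplexMap {m n : ℕ} (φ : Fin (m + 1) → Fin (n + 1)) : C(TopSimplex m, TopSimplex n) :=
  ⟨stdSimplex.map φ, stdSimplex.continuous_map φ⟩

lemma simplexMap_comp {m n k : ℕ} (ψ : Fin (n + 1) → Fin (k + 1)) (φ : Fin (m + 1) → Fin (n + 1)) :
    (simplexMap ψ).comp (simplexMap φ) = simplexMap (ψ ∘ φ) :=
  ContinuousMap.ext fun x => stdSimplex.map_comp_apply φ ψ x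

lemma coe_simplexMap_apply {m n : ℕ} (φ : Fin (m + 1) → Fin (n + 1)) (x : TopSimplex m)
    (j : Fin (n + 1)) :
    (simplexMap φ x : Fin (n + 1) → ℝ) j = ∑ k with φ k = j, (x : Fin (m + 1) → ℝ) k :=
  FunOnFinite.linearMap_apply_apply ℝ ℝ φ x j

lemma coface_eq_simplexMap {n : ℕ} (i : Fin (n + 2)) : coface i = simplexMap i.succAbove := by
  ext x j
  change cofaceFun i (x : Fin (n + 1) → ℝ) j = (simplexMap i.succAbove x : Fin (n + 2) → ℝ) j
  rw [coe_simplexMap_apply, Finset.sum_filter]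
  rfl

/-- The affine map `Δᵐ → Δⁿ × I` sending the `k`-th vertex to `(φ k, τ k)`. -/
def prismMap {m n : ℕ} (φ : Fin (m + 1) → Fin (n + 1)) (τ : Fin (m + 1) → Fin 2) :
    C(TopSimplex m, TopSimplex n × unitInterval) :=
  (simplexMap φ).prodMk
    ((⟨_, stdSimplexHomeomorphUnitInterval.continuous⟩ : C(TopSimplex 1, unitInterval)).comp
      (simplexMap τ))

lemma prismMap_comp_simplexMap {k m n : ℕ} (φ : Fin (m + 1) → Fin (n + 1))
    (τ : Fin (m + 1) → Fin 2) (ψ : Fin (k + 1) → Fin (m + 1)) :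
    (prismMap φ τ).comp (simplexMap ψ) = prismMap (φ ∘ ψ) (τ ∘ ψ) := by
  rw [prismMap, prismMap, ← simplexMap_comp, ← simplexMap_comp]
  rfl

lemma simplexMap_prodMap_comp_prismMap {k m n : ℕ} (φ : Fin (m + 1) → Fin (n + 1))
    (τ : Fin (m + 1) → Fin 2) (χ : Fin (n + 1) → Fin (k + 1)) :
    ((simplexMap χ).prodMap (.id _)).comp (prismMap φ τ) = prismMap (χ ∘ φ) τ := by
  rw [prismMap, prismMap, ← simplexMap_comp]
  rfl

lemma simplexMap_const_apply {m n : ℕ} (j : Fin (n + 1)) (x : TopSimplex m) :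
    simplexMap (fun _ : Fin (m + 1) => j) x = stdSimplex.vertex j := by
  refine stdSimplex.ext (funext fun k => ?_)
  refine (coe_simplexMap_apply _ x k).trans ?_
  rw [stdSimplex.vertex_coe]
  by_cases h : j = k
  · subst h
    simp
  · simp [h, Ne.symm h]

lemma prismMap_id_zero {n : ℕ} (x : TopSimplex n) :
    prismMap id (fun _ => 0) x = (x, 0) := by
  refine Prod.ext (stdSimplex.map_id_apply x) ?_
  change stdSimplexHomeomorphUnitInterval (simplexMap (n := 1) _ x) = 0
  rw [simplexMap_const_apply]
  exact stdSimplexHomeomorphUnitInterval_zero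

lemma prismMap_id_one {n : ℕ} (x : TopSimplex n) :
    prismMap id (fun _ => 1) x = (x, 1) := by
  refine Prod.ext (stdSimplex.map_id_apply x) ?_
  change stdSimplexHomeomorphUnitInterval (simplexMap (n := 1) _ x) = 1
  rw [simplexMap_const_apply]
  exact stdSimplexHomeomorphUnitInterval_one

lemma val_succAbove_eq_ite {n : ℕ} (i : Fin (n + 1)) (k : Fin n) :
    (i.succAbove k : ℕ) = if (k : ℕ) < i then (k : ℕ) else k + 1 := by
  simp only [Fin.succAbove, Fin.lt_def, Fin.val_castSucc]
  split_ifs <;> rfl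

lemma val_predAbove_eq_ite {n : ℕ} (p : Fin n) (i : Fin (n + 1)) :
    (p.predAbove i : ℕ) = if (p : ℕ) < i then (i : ℕ) - 1 else i := by
  simp only [Fin.predAbove, Fin.lt_def, Fin.val_castSucc]
  split_ifs <;> rfl

/-- The height of the vertices of the `i`-th simplex of the prism: the vertices up to `i` lie at
the bottom, the later ones at the top. -/
def prismHeight {n : ℕ} (i : Fin (n + 1)) (j : Fin (n + 2)) : Fin 2 :=
  if (j : ℕ) ≤ i then 0 else 1

/-- The `i`-th simplex `Δⁿ⁺¹ → Δⁿ × I` of the standard triangulation of the prism. -/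
def prismSimplex {n : ℕ} (i : Fin (n + 1)) : C(TopSimplex (n + 1), TopSimplex n × unitInterval) :=
  prismMap i.predAbove (prismHeight i)

lemma prismSimplex_comp_coface {n : ℕ} (i : Fin (n + 1)) (j : Fin (n + 2)) :
    (prismSimplex i).comp (coface j) =
      prismMap (i.predAbove ∘ j.succAbove) (prismHeight i ∘ j.succAbove) := by
  rw [prismSimplex, coface_eq_simplexMap, prismMap_comp_simplexMap]

lemma coface_prodMap_comp_prismSimplex {n : ℕ} (j : Fin (n + 2)) (i : Fin (n + 1)) :
    ((coface j).prodMap (.id _)).comp (prismSimplex i) =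
      prismMap (j.succAbove ∘ i.predAbove) (prismHeight i) := by
  rw [prismSimplex, coface_eq_simplexMap, simplexMap_prodMap_comp_prismMap]

lemma prismSimplex_zero_comp_coface_apply {n : ℕ} (x : TopSimplex n) :
    prismSimplex (0 : Fin (n + 1)) (coface 0 x) = (x, 1) := by
  rw [← prismMap_id_one, ← ContinuousMap.comp_apply, prismSimplex_comp_coface]
  congr 2

lemma prismSimplex_last_comp_coface_apply {n : ℕ} (x : TopSimplex n) :
    prismSimplex (Fin.last n) (coface (Fin.last (n + 1)) x) = (x, 0) := by
  rw [← prismMap_id_zero, ← ContinuousMap.comp_apply, prismSimplex_comp_coface]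
  congr 2 <;> funext k
  · simp
  · simp [prismHeight, Fin.is_le]

lemma prismSimplex_succ_comp_coface {n : ℕ} (i : Fin n) :
    (prismSimplex i.succ).comp (coface i.succ.castSucc) =
      (prismSimplex i.castSucc).comp (coface i.castSucc.succ) := by
  rw [prismSimplex_comp_coface, prismSimplex_comp_coface]
  congr 1 <;> funext k
  · rw [Function.comp_apply, Function.comp_apply]
    simp only [Fin.ext_iff, val_predAbove_eq_ite, val_succAbove_eq_ite, Fin.val_succ,
      Fin.val_castSucc]
    grind
  · simp only [prismHeight, Function.comp_apply, val_succAbove_eq_ite, Fin.val_succ,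
      Fin.val_castSucc]
    grind

lemma prismSimplex_comp_coface_succAbove {n : ℕ} (i : Fin (n + 2)) (l : Fin (n + 1)) :
    (prismSimplex i).comp (coface (i.castSucc.succAbove (i.succAbove l))) =
      ((coface (i.succAbove l)).prodMap (.id _)).comp (prismSimplex (l.predAbove i)) := by
  rw [prismSimplex_comp_coface, coface_prodMap_comp_prismSimplex]
  congr 1 <;> funext k
  · rw [Function.comp_apply, Function.comp_apply]
    simp only [Fin.ext_iff, val_predAbove_eq_ite, val_succAbove_eq_ite, Fin.val_castSucc]
    grind
  · simp only [prismHeight, Function.comp_apply, val_predAbove_eq_ite, val_succAbove_eq_ite,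
      Fin.val_castSucc]
    grind

/-! ### Alternating sums over the faces of a prism -/

lemma sum_prism_faces (R : Type*) [Ring R] {M : Type*} [AddCommGroup M] [Module R M] {n : ℕ}
    (a : Fin (n + 1) → Fin (n + 2) → M)
    (ha : ∀ i : Fin n, a i.succ i.succ.castSucc = a i.castSucc i.castSucc.succ) :
    ∑ i : Fin (n + 1), ∑ j : Fin (n + 2), (-1 : R) ^ ((i : ℕ) + j) • a i j =
      a 0 0 - a (Fin.last n) (Fin.last (n + 1)) +
        ∑ i : Fin (n + 1), ∑ l : Fin n, (-1 : R) ^ ((i : ℕ) + i.castSucc.succAbove (i.succAbove l)) •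
          a i (i.castSucc.succAbove (i.succAbove l)) := by
  have hrow (i : Fin (n + 1)) : ∑ j : Fin (n + 2), (-1 : R) ^ ((i : ℕ) + j) • a i j =
      a i i.castSucc - a i i.succ +
        ∑ l : Fin n, (-1 : R) ^ ((i : ℕ) + i.castSucc.succAbove (i.succAbove l)) •
          a i (i.castSucc.succAbove (i.succAbove l)) := by
    rw [Fin.sum_univ_succAbove _ i.castSucc, Fin.sum_univ_succAbove _ i, ← add_assoc]
    simp [← add_assoc, pow_succ, sub_eq_add_neg, Even.neg_one_pow ⟨(i : ℕ), rfl⟩]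
  have hdiag : ∑ i : Fin (n + 1), (a i i.castSucc - a i i.succ) =
      a 0 0 - a (Fin.last n) (Fin.last (n + 1)) := by
    rw [Finset.sum_sub_distrib, Fin.sum_univ_succ, Fin.sum_univ_castSucc fun i => a i i.succ,
      Finset.sum_congr rfl fun i _ => ha i, add_comm (Finset.sum _ _), add_sub_add_right_eq_sub]
    simp
  rw [Finset.sum_congr rfl fun i _ => hrow i, Finset.sum_add_distrib, hdiag]

lemma sum_prism_outer_faces (R : Type*) [Ring R] {M : Type*} [AddCommGroup M] [Module R M] {n : ℕ}
    (b : Fin (n + 1) → Fin (n + 2) → M) :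
    ∑ i : Fin (n + 2), ∑ l : Fin (n + 1),
        (-1 : R) ^ ((i : ℕ) + i.castSucc.succAbove (i.succAbove l)) •
          b (l.predAbove i) (i.succAbove l) =
      -∑ j : Fin (n + 2), ∑ i : Fin (n + 1), (-1 : R) ^ ((j : ℕ) + i) • b i j := by
  rw [← Finset.sum_neg_distrib]
  simp_rw [← Finset.sum_neg_distrib]
  rw [← Fintype.sum_prod_type', ← Fintype.sum_prod_type']
  refine Finset.sum_nbij' (fun p => (p.1.succAbove p.2, p.2.predAbove p.1))
    (fun p => (p.1.succAbove p.2, p.2.predAbove p.1)) (by simp) (by simp) ?_ ?_ ?_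
  · rintro ⟨i, l⟩ -
    simp only [Fin.succAbove_succAbove_predAbove, Fin.predAbove_predAbove_succAbove]
  · rintro ⟨i, l⟩ -
    simp only [Fin.succAbove_succAbove_predAbove, Fin.predAbove_predAbove_succAbove]
  · rintro ⟨i, l⟩ -
    have hsign : (-1 : R) ^ ((i : ℕ) + i.castSucc.succAbove (i.succAbove l)) =
        -(-1 : R) ^ ((i.succAbove l : ℕ) + l.predAbove i) := by
      rcases lt_or_ge (l : ℕ) i with h | h
      · obtain ⟨k, hk⟩ : ∃ k, (i : ℕ) = k + 1 := ⟨i - 1, by omega⟩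
        have h₁ : (i.castSucc.succAbove (i.succAbove l) : ℕ) = l := by
          simp only [val_succAbove_eq_ite, Fin.val_castSucc]; grind
        have h₂ : (i.succAbove l : ℕ) = l := by
          rw [val_succAbove_eq_ite]; grind
        have h₃ : (l.predAbove i : ℕ) = k := by
          rw [val_predAbove_eq_ite]; grind
        rw [h₁, h₂, h₃, hk, show k + 1 + (l : ℕ) = l + k + 1 by omega, pow_succ, mul_neg_one]
      · have h₁ : (i.castSucc.succAbove (i.succAbove l) : ℕ) = l + 2 := by
          simp only [val_succAbove_eq_ite, Fin.val_castSucc]; grind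
        have h₂ : (i.succAbove l : ℕ) = l + 1 := by
          rw [val_succAbove_eq_ite]; grind
        have h₃ : (l.predAbove i : ℕ) = i := by
          rw [val_predAbove_eq_ite]; grind
        rw [h₁, h₂, h₃, show (i : ℕ) + (l + 2) = l + 1 + i + 1 by omega, pow_succ, mul_neg_one]
    simp [hsign]

/-! ### The prism operator -/

section Prism

variable (R : Type*) [Ring R] {X X' : Type*} [TopologicalSpace X] [TopologicalSpace X']

lemma boundary_single {n : ℕ} (σ : SingularSimplex X (n + 1)) (r : R) :
    boundary R X n (Finsupp.single σ r) = r • boundaryOf R σ := by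
  simp [boundary]

lemma pushChain_single {n : ℕ} (f : C(X, X')) (σ : SingularSimplex X n) (r : R) :
    pushChain R f n (Finsupp.single σ r) = Finsupp.single (f.comp σ) r := by
  simp [pushChain]

lemma boundary_pushChain (f : C(X, X')) (n : ℕ) (c : SingularChain R X (n + 1)) :
    boundary R X' n (pushChain R f (n + 1) c) = pushChain R f n (boundary R X n c) := by
  induction c using Finsupp.induction_linear with
  | zero => simp
  | add c d hc hd => simp [hc, hd]
  | single σ r =>
    simp [pushChain_single, boundary_single, boundaryOf, map_sum, ContinuousMap.comp_assoc]

variable (H : C(X × unitInterval, X'))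

/-- The `i`-th simplex of the prism over `σ`, pushed forward along the homotopy `H`. -/
def homotopySimplex {n : ℕ} (σ : SingularSimplex X n) (i : Fin (n + 1)) :
    SingularSimplex X' (n + 1) :=
  (H.comp (σ.prodMap (.id _))).comp (prismSimplex i)

/-- The prism operator of the homotopy `H`. -/
def prismOperator (n : ℕ) : SingularChain R X n →ₗ[R] SingularChain R X' (n + 1) :=
  Finsupp.lsum ℕ fun σ => LinearMap.toSpanSingleton R _
    (∑ i : Fin (n + 1), Finsupp.single (homotopySimplex H σ i) ((-1 : R) ^ (i : ℕ)))

lemma prismOperator_single {n : ℕ} (σ : SingularSimplex X n) (r : R) :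
    prismOperator R H n (Finsupp.single σ r) =
      r • ∑ i : Fin (n + 1), Finsupp.single (homotopySimplex H σ i) ((-1 : R) ^ (i : ℕ)) := by
  simp [prismOperator]

variable {H} {f g : C(X, X')}

lemma boundary_prismOperator_single (H0 : ∀ x, H (x, 0) = f x) (H1 : ∀ x, H (x, 1) = g x)
    {n : ℕ} (σ : SingularSimplex X n) :
    boundary R X' n (prismOperator R H n (Finsupp.single σ 1)) =
      Finsupp.single (g.comp σ) 1 - Finsupp.single (f.comp σ) 1 +
        ∑ i : Fin (n + 1), ∑ l : Fin n, (-1 : R) ^ ((i : ℕ) + i.castSucc.succAbove (i.succAbove l)) •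
          Finsupp.single ((homotopySimplex H σ i).comp
            (coface (i.castSucc.succAbove (i.succAbove l)))) (1 : R) := by
  have hbot : (homotopySimplex H σ (Fin.last n)).comp (coface (Fin.last (n + 1))) = f.comp σ := by
    ext x
    simp [homotopySimplex, prismSimplex_last_comp_coface_apply, H0]
  have htop : (homotopySimplex H σ 0).comp (coface 0) = g.comp σ := by
    ext x
    simp [homotopySimplex, prismSimplex_zero_comp_coface_apply, H1]
  rw [← htop, ← hbot, ← sum_prism_faces R
    fun i j => Finsupp.single ((homotopySimplex H σ i).comp (coface j)) (1 : R)]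
  · simp [prismOperator_single, boundary_single, boundaryOf, Finset.smul_sum, pow_add]
  · intro i
    simp only [homotopySimplex, ContinuousMap.comp_assoc, prismSimplex_succ_comp_coface]

lemma boundary_prismOperator_zero (H0 : ∀ x, H (x, 0) = f x) (H1 : ∀ x, H (x, 1) = g x)
    (c : SingularChain R X 0) :
    boundary R X' 0 (prismOperator R H 0 c) = pushChain R g 0 c - pushChain R f 0 c := by
  induction c using Finsupp.induction_linear with
  | zero => simp
  | add c d hc hd => simp only [map_add, hc, hd]; abel
  | single σ r =>
    rw [← mul_one r, ← smul_eq_mul, ← Finsupp.smul_single]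
    simp only [map_smul, boundary_prismOperator_single R H0 H1, pushChain_single]
    simp [smul_sub]

lemma boundary_prismOperator_succ (H0 : ∀ x, H (x, 0) = f x) (H1 : ∀ x, H (x, 1) = g x)
    (n : ℕ) (c : SingularChain R X (n + 1)) :
    boundary R X' (n + 1) (prismOperator R H (n + 1) c) =
      pushChain R g (n + 1) c - pushChain R f (n + 1) c -
        prismOperator R H n (boundary R X n c) := by
  induction c using Finsupp.induction_linear with
  | zero => simp
  | add c d hc hd => simp only [map_add, hc, hd]; abel
  | single σ r =>
    rw [← mul_one r, ← smul_eq_mul, ← Finsupp.smul_single]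
    simp only [map_smul, ← smul_sub]
    congr 1
    have hface (i : Fin (n + 2)) (l : Fin (n + 1)) :
        (homotopySimplex H σ i).comp (coface (i.castSucc.succAbove (i.succAbove l))) =
          homotopySimplex H (σ.comp (coface (i.succAbove l))) (l.predAbove i) := by
      simp only [homotopySimplex, ContinuousMap.comp_assoc, prismSimplex_comp_coface_succAbove]
      rfl
    simp only [boundary_prismOperator_single R H0 H1, pushChain_single, hface]
    rw [sum_prism_outer_faces R
      fun i j => Finsupp.single (homotopySimplex H (σ.comp (coface j)) i) (1 : R), ← sub_eq_add_neg]
    simp [prismOperator_single, boundary_single, boundaryOf, Finset.smul_sum, pow_add]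

end Prism

/-! ### Admissibility -/

lemma IsSimplicialSubcomplex.preimage_simplexMap {m n : ℕ} {A : Set (TopSimplex n)}
    (hA : IsSimplicialSubcomplex A) (φ : Fin (m + 1) → Fin (n + 1)) :
    IsSimplicialSubcomplex (simplexMap φ ⁻¹' A) := by
  obtain ⟨𝒮, rfl⟩ := hA
  refine ⟨(fun S => Finset.univ.filter fun k => φ k ∈ S) '' 𝒮, ?_⟩
  rw [Set.biUnion_image, Set.preimage_iUnion₂]
  refine Set.iUnion₂_congr fun S _ => Set.ext fun x => ?_
  have hzero (j : Fin (n + 1)) : (simplexMap φ x : Fin (n + 1) → ℝ) j = 0 ↔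
      ∀ k, φ k = j → (x : Fin (m + 1) → ℝ) k = 0 := by
    rw [coe_simplexMap_apply, Finset.sum_eq_zero_iff_of_nonneg fun k _ => stdSimplex.zero_le x k]
    simp only [Finset.mem_filter, Finset.mem_univ, true_and]
  simp only [faceSet, Set.mem_preimage, Set.mem_ofPred_eq, hzero, Finset.mem_filter,
    Finset.mem_univ, true_and]
  exact ⟨fun h k hk => h _ hk k rfl, fun h j hj k hk => h k (hk ▸ hj)⟩

section Marked

variable (R : Type*) [Ring R] {X X' : Type*} [TopologicalSpace X] [TopologicalSpace X']
  {B : Set X} {B' : Set X'}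

lemma pushChain_mem_admissibleChains {f : C(X, X')} (hf : f ⁻¹' B' = B) {n : ℕ}
    {c : SingularChain R X n} (hc : c ∈ admissibleChains R X B n) :
    pushChain R f n c ∈ admissibleChains R X' B' n := by
  refine Submodule.span_le (p := (admissibleChains R X' B' n).comap (pushChain R f n)) |>.2 ?_ hc
  rintro _ ⟨σ, hσ, rfl⟩
  rw [SetLike.mem_coe, Submodule.mem_comap, pushChain_single]
  refine Submodule.subset_span ⟨_, ?_, rfl⟩
  subst hf
  exact hσ

lemma pushChain_mem_chainsIn {f : C(X, X')} (hf : f ⁻¹' B' = B) {n : ℕ}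
    {c : SingularChain R X n} (hc : c ∈ chainsIn R X B n) :
    pushChain R f n c ∈ chainsIn R X' B' n := by
  refine Submodule.span_le (p := (chainsIn R X' B' n).comap (pushChain R f n)) |>.2 ?_ hc
  rintro _ ⟨σ, hσ, rfl⟩
  rw [SetLike.mem_coe, Submodule.mem_comap, pushChain_single]
  refine Submodule.subset_span ⟨_, ?_, rfl⟩
  subst hf
  rintro _ ⟨x, rfl⟩
  exact hσ ⟨x, rfl⟩

lemma pushChain_mem_markedCycles {f : C(X, X')} (hf : f ⁻¹' B' = B) {n : ℕ}
    {c : SingularChain R X n} (hc : c ∈ markedCycles R X B n) :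
    pushChain R f n c ∈ markedCycles R X' B' n := by
  cases n with
  | zero => exact pushChain_mem_admissibleChains R hf hc
  | succ n =>
    refine ⟨pushChain_mem_admissibleChains R hf hc.1, ?_⟩
    rw [SetLike.mem_coe, Submodule.mem_comap, boundary_pushChain]
    exact pushChain_mem_chainsIn R hf hc.2

lemma prismOperator_mem_of_homotopySimplex {H : C(X × unitInterval, X')} {n : ℕ}
    {p : SingularSimplex X n → Prop} {q : SingularSimplex X' (n + 1) → Prop}
    (hpq : ∀ σ, p σ → ∀ i, q (homotopySimplex H σ i)) {c : SingularChain R X n}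
    (hc : c ∈ Submodule.span R {c | ∃ σ, p σ ∧ c = Finsupp.single σ (1 : R)}) :
    prismOperator R H n c ∈ Submodule.span R {c | ∃ σ, q σ ∧ c = Finsupp.single σ (1 : R)} := by
  refine Submodule.span_le (p := (Submodule.span R _).comap (prismOperator R H n)) |>.2 ?_ hc
  rintro _ ⟨σ, hσ, rfl⟩
  rw [SetLike.mem_coe, Submodule.mem_comap, prismOperator_single, one_smul]
  refine Submodule.sum_mem _ fun i _ => ?_
  rw [← mul_one ((-1 : R) ^ (i : ℕ)), ← smul_eq_mul, ← Finsupp.smul_single]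
  exact Submodule.smul_mem _ _ (Submodule.subset_span ⟨_, hpq σ hσ i, rfl⟩)

variable {H : C(X × unitInterval, X')}

lemma homotopySimplex_preimage (Hadm : ∀ x t, H (x, t) ∈ B' ↔ x ∈ B) {n : ℕ}
    (σ : SingularSimplex X n) (i : Fin (n + 1)) :
    homotopySimplex H σ i ⁻¹' B' = simplexMap i.predAbove ⁻¹' (σ ⁻¹' B) :=
  Set.ext fun _ => Hadm _ _

lemma prismOperator_mem_admissibleChains (Hadm : ∀ x t, H (x, t) ∈ B' ↔ x ∈ B) {n : ℕ}
    {c : SingularChain R X n} (hc : c ∈ admissibleChains R X B n) :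
    prismOperator R H n c ∈ admissibleChains R X' B' (n + 1) := by
  refine prismOperator_mem_of_homotopySimplex R (fun σ hσ i => ?_) hc
  rw [Admissible, homotopySimplex_preimage Hadm]
  exact hσ.preimage_simplexMap _

lemma prismOperator_mem_chainsIn (Hadm : ∀ x t, H (x, t) ∈ B' ↔ x ∈ B) {n : ℕ}
    {c : SingularChain R X n} (hc : c ∈ chainsIn R X B n) :
    prismOperator R H n c ∈ chainsIn R X' B' (n + 1) := by
  refine prismOperator_mem_of_homotopySimplex R (fun σ hσ i => ?_) hc
  rintro _ ⟨x, rfl⟩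
  exact (Hadm _ _).2 (hσ ⟨_, rfl⟩)

end Marked

/-- Admissibly homotopic admissible maps between marked spaces induce the same homomorphism
on marked homology: the push-forward of every marked cycle along either map is a marked
cycle, and the two push-forwards differ by a marked boundary. -/
theorem marked_homology_homotopy_invariance {X X' : Type*} [TopologicalSpace X]
    [TopologicalSpace X'] {B : Set X} {B' : Set X'}
    (hXB : IsMarkedSpace X B) (hXB' : IsMarkedSpace X' B') (R : Type*) [Ring R]
    (f g : C(X, X')) (hf : ⇑f ⁻¹' B' = B) (hg : ⇑g ⁻¹' B' = B)
    (H : C(X × unitInterval, X'))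
    (H0 : ∀ x, H (x, 0) = f x) (H1 : ∀ x, H (x, 1) = g x)
    (Hadm : ∀ x t, H (x, t) ∈ B' ↔ x ∈ B)
    (n : ℕ) (c : SingularChain R X n) (hc : c ∈ markedCycles R X B n) :
    pushChain R f n c ∈ markedCycles R X' B' n ∧
    pushChain R g n c ∈ markedCycles R X' B' n ∧
    pushChain R f n c - pushChain R g n c ∈ markedBoundaries R X' B' n := by
  refine ⟨pushChain_mem_markedCycles R hf hc, pushChain_mem_markedCycles R hg hc, ?_⟩
  rw [← neg_sub, neg_mem_iff]
  cases n with
  | zero =>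
    rw [← boundary_prismOperator_zero R H0 H1]
    exact Submodule.mem_sup_left
      (Submodule.mem_map_of_mem (prismOperator_mem_admissibleChains R Hadm hc))
  | succ n =>
    rw [← sub_add_cancel (pushChain R g (n + 1) c - pushChain R f (n + 1) c)
      (prismOperator R H n (boundary R X n c)), ← boundary_prismOperator_succ R H0 H1]
    exact Submodule.add_mem_sup
      (Submodule.mem_map_of_mem (prismOperator_mem_admissibleChains R Hadm hc.1))
      (prismOperator_mem_chainsIn R Hadm hc.2)
end
end

section
/- Let F be a quasicone with apex b ∈ F. Then the marked homology H^M_n(F,{b};R) vanishes for every n ≥ 0 and every coefficient ring R. -/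
open scoped BigOperators
open Topology
noncomputable section

lemma coface_apply_self {n : ℕ} (i : Fin (n + 2)) (x : TopSimplex n) : coface i x i = 0 := by
  change cofaceFun i x i = 0
  simp [cofaceFun, Fin.succAbove_ne]

lemma coface_apply_succAbove {n : ℕ} (i : Fin (n + 2)) (x : TopSimplex n) (k : Fin (n + 1)) :
    coface i x (i.succAbove k) = x k := by
  change cofaceFun i x (i.succAbove k) = x k
  simp [cofaceFun]

/-- The join parametrisation `Δⁿ × [0,1] → Δⁿ⁺¹`, `(x, t) ↦ (t, (1 - t) x)`, collapsing
`Δⁿ × {1}` to the vertex `0`. -/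
def conePoint (n : ℕ) : C(TopSimplex n × unitInterval, TopSimplex (n + 1)) where
  toFun p := ⟨Fin.cons (p.2 : ℝ) fun k => (1 - (p.2 : ℝ)) * p.1 k, by
    constructor
    · intro j
      refine Fin.cases ?_ (fun k => ?_) j
      · exact p.2.2.1
      · exact mul_nonneg (sub_nonneg.2 p.2.2.2) (p.1.2.1 k)
    · rw [Fin.sum_univ_succ]
      simp only [Fin.cons_zero, Fin.cons_succ]
      rw [← Finset.mul_sum, stdSimplex.sum_eq_one p.1]
      ring⟩
  continuous_toFun := by
    refine Continuous.subtype_mk (continuous_pi fun j => ?_) _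
    refine Fin.cases ?_ (fun k => ?_) j
    · exact continuous_subtype_val.comp continuous_snd
    · simp only [Fin.cons_succ]
      have hk : Continuous fun p : TopSimplex n × unitInterval => p.1 k :=
        (continuous_apply k).comp (continuous_subtype_val.comp continuous_fst)
      fun_prop

lemma conePoint_zero {n : ℕ} (x : TopSimplex n) (t : unitInterval) :
    conePoint n (x, t) 0 = t := rfl

lemma conePoint_succ {n : ℕ} (x : TopSimplex n) (t : unitInterval) (k : Fin (n + 1)) :
    conePoint n (x, t) k.succ = (1 - (t : ℝ)) * x k := rfl

lemma conePoint_surjective (n : ℕ) : Function.Surjective (conePoint n) := by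
  intro y
  have hsum : y 0 + ∑ k : Fin (n + 1), y k.succ = 1 := by
    rw [← Fin.sum_univ_succ]; exact stdSimplex.sum_eq_one y
  have hnn : ∀ k : Fin (n + 1), 0 ≤ y k.succ := fun k => y.2.1 _
  have hle : y 0 ≤ 1 := by
    have := Finset.sum_nonneg fun k (_ : k ∈ Finset.univ) => hnn k
    linarith
  rcases eq_or_lt_of_le hle with h | h
  · refine ⟨(⟨_, single_mem_stdSimplex ℝ (0 : Fin (n + 1))⟩, 1), DFunLike.ext _ _ fun j => ?_⟩
    refine Fin.cases ?_ (fun k => ?_) j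
    · exact h.symm
    · have h0 : ∑ k : Fin (n + 1), y k.succ = 0 := by linarith
      rw [(Finset.sum_eq_zero_iff_of_nonneg fun k _ => hnn k).1 h0 k (Finset.mem_univ k)]
      simp [conePoint_succ]
  · have hpos : 0 < 1 - y 0 := sub_pos.2 h
    refine ⟨(⟨fun k => y k.succ / (1 - y 0),
      fun k => div_nonneg (hnn k) hpos.le, ?_⟩, ⟨y 0, y.2.1 0, hle⟩),
      DFunLike.ext _ _ fun j => ?_⟩
    · rw [← Finset.sum_div, div_eq_one_iff_eq hpos.ne']
      linarith
    · refine Fin.cases rfl (fun k => ?_) j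
      rw [conePoint_succ]
      exact mul_div_cancel₀ _ hpos.ne'

lemma isQuotientMap_conePoint (n : ℕ) : IsQuotientMap (conePoint n) :=
  (conePoint n).continuous.isClosedMap.isQuotientMap (conePoint n).continuous
    (conePoint_surjective n)

lemma conePoint_eq_imp {n : ℕ} {x x' : TopSimplex n} {t t' : unitInterval}
    (h : conePoint n (x, t) = conePoint n (x', t')) : t = t' ∧ (t = 1 ∨ x = x') := by
  have ht : t = t' := Subtype.ext (DFunLike.congr_fun h 0)
  subst ht
  refine ⟨rfl, or_iff_not_imp_left.2 fun h1 => DFunLike.ext _ _ fun k => ?_⟩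
  have hk := DFunLike.congr_fun h k.succ
  rw [conePoint_succ, conePoint_succ] at hk
  exact mul_left_cancel₀ (sub_ne_zero.2 fun h => h1 (Subtype.ext h.symm)) hk

lemma coface_zero_eq_conePoint {n : ℕ} (x : TopSimplex n) : coface 0 x = conePoint n (x, 0) := by
  refine DFunLike.ext _ _ fun j => ?_
  refine Fin.cases ?_ (fun k => ?_) j
  · exact coface_apply_self 0 x
  · rw [conePoint_succ]
    simpa using coface_apply_succAbove 0 x k

lemma coface_succ_conePoint {n : ℕ} (i : Fin (n + 2)) (x : TopSimplex n) (t : unitInterval) :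
    coface i.succ (conePoint n (x, t)) = conePoint (n + 1) (coface i x, t) := by
  refine DFunLike.ext _ _ fun j => ?_
  refine Fin.cases ?_ (fun k => ?_) j
  · simpa [conePoint_zero] using coface_apply_succAbove i.succ (conePoint n (x, t)) 0
  · rw [conePoint_succ]
    induction k using Fin.succAboveCases i with
    | x => simp [coface_apply_self]
    | p l =>
      rw [← Fin.succ_succAbove_succ, coface_apply_succAbove, coface_apply_succAbove,
        conePoint_succ]

section Cone

variable {F : Type*} [TopologicalSpace F] {b : F} (H : C(F × unitInterval, F))
  (h1 : ∀ x, H (x, 1) = b)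

lemma factorsThrough_conePoint (H : C(F × unitInterval, F)) (h1 : ∀ x, H (x, 1) = b) {n : ℕ}
    (σ : SingularSimplex F n) :
    Function.FactorsThrough (H.comp (σ.prodMap (ContinuousMap.id unitInterval))) (conePoint n) := by
  rintro ⟨x, t⟩ ⟨x', t'⟩ h
  obtain ⟨rfl, rfl | rfl⟩ := conePoint_eq_imp h
  · exact (h1 _).trans (h1 _).symm
  · rfl

/-- The cone over a singular simplex along a contraction `H` of `F` to `b`. -/
def coneSimplex {n : ℕ} (σ : SingularSimplex F n) : SingularSimplex F (n + 1) :=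
  (isQuotientMap_conePoint n).lift _ (factorsThrough_conePoint H h1 σ)

lemma coneSimplex_conePoint {n : ℕ} (σ : SingularSimplex F n) (x : TopSimplex n)
    (t : unitInterval) : coneSimplex H h1 σ (conePoint n (x, t)) = H (σ x, t) :=
  DFunLike.congr_fun
    ((isQuotientMap_conePoint n).lift_comp _ (factorsThrough_conePoint H h1 σ)) (x, t)

lemma coneSimplex_comp_coface_zero (h0 : ∀ x, H (x, 0) = x) {n : ℕ} (σ : SingularSimplex F n) :
    (coneSimplex H h1 σ).comp (coface 0) = σ := by
  ext x
  rw [ContinuousMap.comp_apply, coface_zero_eq_conePoint, coneSimplex_conePoint, h0]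

lemma coneSimplex_comp_coface_succ {n : ℕ} (σ : SingularSimplex F (n + 1)) (i : Fin (n + 2)) :
    (coneSimplex H h1 σ).comp (coface i.succ) = coneSimplex H h1 (σ.comp (coface i)) := by
  ext y
  obtain ⟨⟨x, t⟩, rfl⟩ := conePoint_surjective n y
  rw [ContinuousMap.comp_apply, coface_succ_conePoint, coneSimplex_conePoint,
    coneSimplex_conePoint, ContinuousMap.comp_apply]

lemma coneSimplex_comp_coface_one (σ : SingularSimplex F 0) :
    (coneSimplex H h1 σ).comp (coface 1) = ContinuousMap.const _ b := by
  ext x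
  have hx : x 0 = 1 := by simp
  have : coface 1 x = conePoint 0 (x, 1) := by
    refine DFunLike.ext _ _ fun j => ?_
    refine Fin.cases ?_ (fun k => ?_) j
    · exact (coface_apply_succAbove 1 x 0).trans hx
    · rw [Subsingleton.elim k 0, conePoint_succ]
      simpa using coface_apply_self 1 x
  rw [ContinuousMap.comp_apply, this, coneSimplex_conePoint, h1, ContinuousMap.const_apply]

lemma conePoint_mem_faceSet_singleton_zero {n : ℕ} (x : TopSimplex n) (t : unitInterval) :
    conePoint n (x, t) ∈ faceSet (n + 1) {0} ↔ t = 1 := by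
  constructor
  · intro h
    have hs := stdSimplex.sum_eq_one (conePoint n (x, t))
    rw [Fin.sum_univ_succ, Finset.sum_eq_zero fun k _ => h k.succ (by simp), add_zero] at hs
    exact Subtype.ext hs
  · rintro rfl j hj
    obtain ⟨k, rfl⟩ := Fin.exists_succ_eq.2 (by simpa using hj)
    simp [conePoint_succ]

lemma conePoint_mem_faceSet_insert_zero {n : ℕ} (S : Finset (Fin (n + 1))) (x : TopSimplex n)
    (t : unitInterval) :
    conePoint n (x, t) ∈ faceSet (n + 1) (insert 0 (S.map (Fin.succEmb (n + 1)))) ↔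
      t = 1 ∨ x ∈ faceSet n S := by
  constructor
  · refine fun h => or_iff_not_imp_left.2 fun ht k hk => ?_
    have := h k.succ (by simpa using hk)
    rw [conePoint_succ] at this
    exact (mul_eq_zero.1 this).resolve_left (sub_ne_zero.2 fun h => ht (Subtype.ext h.symm))
  · intro h j hj
    obtain ⟨k, rfl⟩ := Fin.exists_succ_eq.2 (fun h : j = 0 => hj (by simp [h]))
    rw [conePoint_succ]
    rcases h with rfl | h
    · simp
    · rw [h k (by simpa using hj), mul_zero]

lemma Admissible.coneSimplex (hb : ∀ x t, H (x, t) = b ↔ x = b ∨ t = 1) {n : ℕ}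
    {σ : SingularSimplex F n} (hσ : Admissible {b} σ) :
    Admissible {b} (coneSimplex H h1 σ) := by
  obtain ⟨𝒮, h𝒮⟩ := hσ
  refine ⟨insert {0} (Set.image (fun S => insert 0 (S.map (Fin.succEmb (n + 1)))) 𝒮), ?_⟩
  ext y
  obtain ⟨⟨x, t⟩, rfl⟩ := conePoint_surjective n y
  have hx : σ x = b ↔ ∃ S ∈ 𝒮, x ∈ faceSet n S := by
    simpa using Set.ext_iff.1 h𝒮 x
  simp only [Set.mem_preimage, Set.mem_singleton_iff, coneSimplex_conePoint, hb, hx,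
    Set.biUnion_insert, Set.biUnion_image, Set.mem_union, Set.mem_iUnion, exists_prop,
    conePoint_mem_faceSet_singleton_zero, conePoint_mem_faceSet_insert_zero]
  grind

lemma range_coneSimplex_subset (hb : ∀ x t, H (x, t) = b ↔ x = b ∨ t = 1) {n : ℕ}
    {σ : SingularSimplex F n} (hσ : Set.range σ ⊆ {b}) :
    Set.range (coneSimplex H h1 σ) ⊆ {b} := by
  rintro _ ⟨y, rfl⟩
  obtain ⟨⟨x, t⟩, rfl⟩ := conePoint_surjective n y
  rw [coneSimplex_conePoint]
  exact (hb _ _).2 (Or.inl (hσ ⟨x, rfl⟩))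

variable (R : Type*) [Ring R]

/-- The cone operator on singular chains. -/
def coneChain (n : ℕ) : SingularChain R F n →ₗ[R] SingularChain R F (n + 1) :=
  Finsupp.lmapDomain R R (coneSimplex H h1)

lemma coneChain_single {n : ℕ} (σ : SingularSimplex F n) (r : R) :
    coneChain H h1 R n (Finsupp.single σ r) = Finsupp.single (coneSimplex H h1 σ) r :=
  Finsupp.mapDomain_single

lemma boundary_single_one {n : ℕ} (σ : SingularSimplex F (n + 1)) :
    boundary R F n (Finsupp.single σ 1) = boundaryOf R σ := by
  simp [boundary]

lemma coneChain_mem_admissibleChains (hb : ∀ x t, H (x, t) = b ↔ x = b ∨ t = 1) {n : ℕ}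
    {c : SingularChain R F n} (hc : c ∈ admissibleChains R F {b} n) :
    coneChain H h1 R n c ∈ admissibleChains R F {b} (n + 1) := by
  suffices h : admissibleChains R F {b} n ≤
      (admissibleChains R F {b} (n + 1)).comap (coneChain H h1 R n) from h hc
  refine Submodule.span_le.2 ?_
  rintro _ ⟨σ, hσ, rfl⟩
  exact Submodule.subset_span ⟨_, hσ.coneSimplex H h1 hb, coneChain_single H h1 R σ 1⟩

lemma coneChain_mem_chainsIn (hb : ∀ x t, H (x, t) = b ↔ x = b ∨ t = 1) {n : ℕ}
    {c : SingularChain R F n} (hc : c ∈ chainsIn R F {b} n) :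
    coneChain H h1 R n c ∈ chainsIn R F {b} (n + 1) := by
  suffices h : chainsIn R F {b} n ≤
      (chainsIn R F {b} (n + 1)).comap (coneChain H h1 R n) from h hc
  refine Submodule.span_le.2 ?_
  rintro _ ⟨σ, hσ, rfl⟩
  exact Submodule.subset_span
    ⟨_, range_coneSimplex_subset H h1 hb hσ, coneChain_single H h1 R σ 1⟩

lemma boundary_coneChain_add (h0 : ∀ x, H (x, 0) = x) {n : ℕ} (c : SingularChain R F (n + 1)) :
    boundary R F (n + 1) (coneChain H h1 R (n + 1) c) +
      coneChain H h1 R n (boundary R F n c) = c := by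
  suffices h : boundary R F (n + 1) ∘ₗ coneChain H h1 R (n + 1) +
      coneChain H h1 R n ∘ₗ boundary R F n = LinearMap.id from LinearMap.congr_fun h c
  refine Finsupp.lhom_ext' fun σ => LinearMap.ext_ring ?_
  simp only [LinearMap.comp_apply, LinearMap.add_apply, Finsupp.lsingle_apply, coneChain_single,
    boundary_single_one, boundaryOf, map_sum, LinearMap.id_apply]
  rw [Fin.sum_univ_succ]
  simp [coneSimplex_comp_coface_zero H h1 h0, coneSimplex_comp_coface_succ, pow_succ,
    Finset.sum_neg_distrib]

lemma sub_boundary_coneChain_mem_chainsIn (h0 : ∀ x, H (x, 0) = x) (c : SingularChain R F 0) :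
    c - boundary R F 0 (coneChain H h1 R 0 c) ∈ chainsIn R F {b} 0 := by
  induction c using Finsupp.induction_linear with
  | zero => simp
  | add c d hc hd =>
    rw [map_add, map_add, add_sub_add_comm]
    exact add_mem hc hd
  | single σ r =>
    have key : Finsupp.single σ (1 : R) - boundary R F 0 (coneChain H h1 R 0 (Finsupp.single σ 1)) =
        Finsupp.single (ContinuousMap.const _ b) 1 := by
      rw [coneChain_single, boundary_single_one, boundaryOf, Fin.sum_univ_two,
        coneSimplex_comp_coface_zero H h1 h0, coneSimplex_comp_coface_one]
      simp
    rw [← mul_one r, ← smul_eq_mul, ← Finsupp.smul_single, map_smul, map_smul, ← smul_sub, key]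
    refine Submodule.smul_mem _ _ (Submodule.subset_span ⟨_, ?_, rfl⟩)
    rintro _ ⟨x, rfl⟩
    rfl

end Cone

/-- The marked homology of a quasicone `F` with apex `b` (relative to the marking `{b}`)
vanishes in every degree and for every coefficient ring: every marked cycle is a marked
boundary. -/
theorem marked_homology_quasicone_vanishes {F : Type*} [TopologicalSpace F] {b : F}
    (hF : IsQuasicone b) (R : Type*) [Ring R] (n : ℕ) :
    markedCycles R F {b} n ≤ markedBoundaries R F {b} n := by
  obtain ⟨H, h0, h1, hb⟩ := hF
  intro c hc
  cases n with
  | zero =>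
    rw [← add_sub_cancel (boundary R F 0 (coneChain H h1 R 0 c)) c]
    exact Submodule.add_mem_sup
      (Submodule.mem_map_of_mem (coneChain_mem_admissibleChains H h1 R hb hc))
      (sub_boundary_coneChain_mem_chainsIn H h1 R h0 c)
  | succ n =>
    rw [← boundary_coneChain_add H h1 R h0 c]
    exact Submodule.add_mem_sup
      (Submodule.mem_map_of_mem (coneChain_mem_admissibleChains H h1 R hb hc.1))
      (coneChain_mem_chainsIn H h1 R hb hc.2)
end
end
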